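/- In every allocation instance with monotone valuations there exists a full allocation (a partition of all of M into A_1,...,A_n) that is simultaneously RMMS and EFL. -/

import Mathlib

open Finset

/-- `P` is a partition of the finite set `X` into `n` (possibly empty) parts. -/
def IsPartitionOn {M : Type*} [DecidableEq M] {n : ℕ} (X : Finset M) (P : Fin n → Finset M) : Prop :=
  (∀ i j, i ≠ j → Disjoint (P i) (P j)) ∧ Finset.univ.biUnion P = X

/-- `t` is residual self-feasible for valuation `v` on the item set `X` with `n` agents:
for every `0 ≤ k < n`, after removing any `k` pairwise disjoint bundles of `X`, each of
`v`-value strictly less than `t`, the remaining items admit an `(n-k)`-partition in which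
every part has `v`-value at least `t`. -/
def RSF {M : Type*} [DecidableEq M] {α : Type*} [Preorder α] (v : Finset M → α) (n : ℕ)
    (X : Finset M) (t : α) : Prop :=
  ∀ k, k < n → ∀ B : Fin k → Finset M,
    (∀ i j, i ≠ j → Disjoint (B i) (B j)) → (∀ i, B i ⊆ X) → (∀ i, v (B i) < t) →
    ∃ P : Fin (n - k) → Finset M,
      (∀ i j, i ≠ j → Disjoint (P i) (P j)) ∧
      Finset.univ.biUnion P = X \ Finset.univ.biUnion B ∧
      ∀ i, t ≤ v (P i)

/-- Among the elements satisfying `p` there is one maximizing `f`, and `g` among ties. -/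
theorem exists_lex_max {α : Type*} [Finite α] (p : α → Prop) (hp : ∃ x, p x)
    (f : α → ℕ) (g : α → NNReal) :
    ∃ x, p x ∧ ∀ y, p y → f y < f x ∨ (f y = f x ∧ g y ≤ g x) := by
  obtain ⟨x, hx, hmax⟩ := Set.exists_max_image {x | p x} (fun x => toLex (f x, g x))
    (Set.toFinite _) hp
  refine ⟨x, hx, fun y hy => ?_⟩
  simpa [Prod.Lex.le_iff] using hmax y hy

/-- A minimal tight set of a bipartite graph without isolated vertices on the left can be
perfectly matched with its neighbourhood; `g` is the matching, read from right to left. -/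
theorem exists_closed_matching {ι α : Type*} [Fintype ι] [Nonempty ι] [DecidableEq ι]
    [DecidableEq α] (N : ι → Finset α) (hne : ∀ t, (N t).Nonempty)
    (hcard : (univ.biUnion N).card ≤ Fintype.card ι) :
    ∃ T : Finset α, T.Nonempty ∧ ∃ g : α → ι, Set.InjOn g T ∧ (∀ a ∈ T, a ∈ N (g a)) ∧
      ∀ a ∈ T, N (g a) ⊆ T := by
  obtain ⟨Q, ⟨hQne, hQ⟩, hmin⟩ := Set.exists_min_image
    {Q : Finset ι | Q.Nonempty ∧ (Q.biUnion N).card ≤ Q.card} Finset.card (Set.toFinite _)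
    ⟨univ, univ_nonempty, hcard⟩
  have hlt : ∀ R : Finset ι, R.Nonempty → R.card < Q.card → R.card < (R.biUnion N).card := by
    intro R hR hRQ
    by_contra! h
    exact absurd (hmin R ⟨hR, h⟩) (by omega)
  have hall_Q : Q.card ≤ (Q.biUnion N).card := by
    obtain ⟨q, hq⟩ := hQne
    have hsub : (Q.erase q).biUnion N ⊆ Q.biUnion N :=
      biUnion_subset_biUnion_of_subset_left _ (erase_subset _ _)
    have hle := card_le_card hsub
    have hc := card_erase_add_one hq
    rcases (Q.erase q).eq_empty_or_nonempty with h0 | h0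
    · have h1 : (N q).card ≤ (Q.biUnion N).card :=
        card_le_card (subset_biUnion_of_mem N hq)
      have h2 := (hne q).card_pos
      rw [h0, card_empty] at hc
      omega
    · have := hlt _ h0 (by omega)
      omega
  have hall : ∀ R : Finset Q, R.card ≤ (R.biUnion fun q => N q).card := by
    intro R
    have hR : (R.biUnion fun q => N q) = (R.map (Function.Embedding.subtype _)).biUnion N := by
      ext; simp
    rw [hR, ← card_map (Function.Embedding.subtype _)]
    have hsub : R.map (Function.Embedding.subtype _) ⊆ Q := by
      intro x hx
      simp only [mem_map, Function.Embedding.subtype_apply] at hx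
      obtain ⟨y, -, rfl⟩ := hx
      exact y.2
    rcases (R.map (Function.Embedding.subtype _)).eq_empty_or_nonempty with h0 | h0
    · simp [h0]
    · rcases hsub.eq_or_ssubset with h | h
      · rw [h]; exact hall_Q
      · exact (hlt _ h0 (card_lt_card h)).le
  obtain ⟨f, hinj, hf⟩ := (all_card_le_biUnion_card_iff_exists_injective _).1 hall
  have himage : univ.image f = Q.biUnion N := by
    apply eq_of_subset_of_card_le
    · intro a ha
      simp only [mem_image, mem_univ, true_and] at ha
      obtain ⟨q, rfl⟩ := ha
      exact mem_biUnion.2 ⟨q, q.2, hf q⟩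
    · rw [card_image_of_injective _ hinj]
      simpa using hQ
  have hsurj : ∀ a ∈ Q.biUnion N, ∃ q : Q, f q = a := by
    intro a ha
    rw [← himage] at ha
    simpa using ha
  obtain ⟨q₀, hq₀⟩ := hQne
  have : Nonempty Q := ⟨⟨q₀, hq₀⟩⟩
  have hinv : ∀ a ∈ Q.biUnion N, f (Function.invFun f a) = a := fun a ha =>
    Function.invFun_eq (hsurj a ha)
  refine ⟨Q.biUnion N, ⟨_, mem_biUnion.2 ⟨q₀, hq₀, (hne q₀).choose_spec⟩⟩,
    fun a => (Function.invFun f a : Q), ?_, ?_, ?_⟩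
  · intro a ha b hb hab
    rw [← hinv a ha, ← hinv b hb, Subtype.ext hab]
  · intro a ha
    have := hf (Function.invFun f a)
    rwa [hinv a ha] at this
  · intro a _
    exact subset_biUnion_of_mem N (Function.invFun f a : Q).2

/-- A self-map of a nonempty finite type agrees on a nonempty set with a permutation that
fixes everything else. -/
theorem exists_perm_of_self_map {α : Type*} [Finite α] [Nonempty α] (p : α → α) :
    ∃ σ : Equiv.Perm α, (∃ j, σ j = p j) ∧ ∀ j, σ j = p j ∨ σ j = j := by
  classical
  have hne : (Function.periodicPts p).Nonempty := by
    obtain ⟨x⟩ := ‹Nonempty α›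
    obtain ⟨a, b, hab, h⟩ := Finite.exists_ne_map_eq_of_infinite fun k : ℕ => p^[k] x
    wlog hlt : a < b generalizing a b
    · exact this b a hab.symm h.symm (by omega)
    refine ⟨p^[a] x, Function.mk_mem_periodicPts (n := b - a) (by omega) ?_⟩
    rw [Function.IsPeriodicPt, Function.IsFixedPt, ← Function.iterate_add_apply,
      Nat.sub_add_cancel hlt.le]
    exact h.symm
  have hbij := Function.bijOn_periodicPts p
  have hinj : Function.Injective fun j => if j ∈ Function.periodicPts p then p j else j := by
    intro a b hab
    by_cases ha : a ∈ Function.periodicPts p <;> by_cases hb : b ∈ Function.periodicPts p <;>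
      simp only [ha, hb, if_true, if_false] at hab
    · exact hbij.injOn ha hb hab
    · exact absurd (hab ▸ hbij.mapsTo ha) hb
    · exact absurd (hab ▸ hbij.mapsTo hb) ha
    · exact hab
  refine ⟨Equiv.ofBijective _ (Finite.injective_iff_bijective.1 hinj), ?_, ?_⟩
  · obtain ⟨j, hj⟩ := hne
    exact ⟨j, by simp [hj]⟩
  · intro j
    by_cases hj : j ∈ Function.periodicPts p <;> simp [hj]

/-- If agent `i` weakly prefers `B` to its bundle, then giving `B` to `i` hurts nobody. -/
theorem le_update {ι β γ : Type*} [DecidableEq ι] [Preorder γ] {v : ι → β → γ} {A : ι → β}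
    {i : ι} {B : β} (hle : v i (A i) ≤ v i B) (l : ι) :
    v l (A l) ≤ v l (Function.update A i B l) := by
  by_cases hl : l = i
  · subst hl; simpa using hle
  · simp [hl]

section Allocation

variable {M : Type*} [DecidableEq M] {n : ℕ}

/-- The agents of `S` hold disjoint bundles forming an EFX allocation in which each of them
reaches its threshold `r i`, while no other agent finds one of these bundles acceptable. -/
structure IsPartialEFX (v : Fin n → Finset M → NNReal) (r : Fin n → NNReal)
    (S : Finset (Fin n)) (A : Fin n → Finset M) : Prop where
  disj : ∀ i ∈ S, ∀ j ∈ S, i ≠ j → Disjoint (A i) (A j)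
  share : ∀ i ∈ S, r i ≤ v i (A i)
  efx : ∀ i ∈ S, ∀ j ∈ S, ∀ e ∈ A j, v i (A j \ {e}) ≤ v i (A i)
  out : ∀ i ∉ S, ∀ j ∈ S, v i (A j) < r i

/-- Agent `i` would take the bundle `B`: it improves on the bundle held by `i`, or, for an agent
without a bundle, it reaches the threshold. -/
def Wants (v : Fin n → Finset M → NNReal) (r : Fin n → NNReal) (S : Finset (Fin n))
    (A : Fin n → Finset M) (B : Finset M) (i : Fin n) : Prop :=
  (i ∈ S ∧ v i (A i) < v i B) ∨ (i ∉ S ∧ r i ≤ v i B)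

variable {v : Fin n → Finset M → NNReal} {r : Fin n → NNReal} {S : Finset (Fin n)}
  {A : Fin n → Finset M}

/-- Replacing the bundle of an agent by a better one keeps a partial EFX allocation when no agent
wants a proper part of the new bundle. -/
theorem IsPartialEFX.update (h : IsPartialEFX v r S A) {i : Fin n} (hi : i ∈ S) {B : Finset M}
    (hB : ∀ j ∈ S, j ≠ i → Disjoint (A j) B) (hlt : v i (A i) < v i B)
    (hmin : ∀ e ∈ B, ∀ l, ¬ Wants v r S A (B \ {e}) l) (hout : ∀ l ∉ S, v l B < r l) :
    IsPartialEFX v r S (Function.update A i B) := by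
  have hle := le_update hlt.le
  constructor
  · intro a ha b hb hab
    by_cases hai : a = i
    · subst hai
      simpa [hab.symm] using (hB b hb hab.symm).symm
    · by_cases hbi : b = i
      · subst hbi
        simpa [hai] using hB a ha hai
      · simpa [hai, hbi] using h.disj a ha b hb hab
  · exact fun a ha => (h.share a ha).trans (hle a)
  · intro a ha b hb e he
    refine le_trans ?_ (hle a)
    by_cases hbi : b = i
    · subst hbi
      simp only [Function.update_self] at he ⊢
      by_contra! hc
      exact hmin e he a (Or.inl ⟨ha, hc⟩)
    · simp only [Function.update_of_ne hbi] at he ⊢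
      exact h.efx a ha b hb e he
  · intro a ha b hb
    by_cases hbi : b = i
    · subst hbi; simpa using hout a ha
    · simpa [hbi] using h.out a ha b hb

/-- New agents `T` may join a partial EFX allocation with acceptable bundles of which no agent
wants a proper part and which no agent left outside finds acceptable. -/
theorem IsPartialEFX.union (hmono : ∀ i, ∀ S T : Finset M, S ⊆ T → v i S ≤ v i T)
    (h : IsPartialEFX v r S A) {T : Finset (Fin n)} (hT : Disjoint S T)
    {B : Fin n → Finset M}
    (hAB : ∀ i ∈ S, ∀ j ∈ T, Disjoint (A i) (B j))
    (hBB : ∀ i ∈ T, ∀ j ∈ T, i ≠ j → Disjoint (B i) (B j))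
    (hshare : ∀ i ∈ T, r i ≤ v i (B i))
    (hmin : ∀ j ∈ T, ∀ e ∈ B j, ∀ l, ¬ Wants v r S A (B j \ {e}) l)
    (hout : ∀ l, l ∉ S → l ∉ T → ∀ j ∈ T, v l (B j) < r l) :
    IsPartialEFX v r (S ∪ T) fun i => if i ∈ S then A i else B i := by
  have hTS : ∀ i ∈ T, i ∉ S := fun i hi hiS => Finset.disjoint_left.1 hT hiS hi
  constructor
  · intro a ha b hb hab
    rcases mem_union.1 ha with ha | ha <;> rcases mem_union.1 hb with hb | hb
    · simpa [ha, hb] using h.disj a ha b hb hab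
    · simpa [ha, hTS b hb] using hAB a ha b hb
    · simpa [hb, hTS a ha] using (hAB b hb a ha).symm
    · simpa [hTS a ha, hTS b hb] using hBB a ha b hb hab
  · intro a ha
    rcases mem_union.1 ha with ha | ha
    · simpa [ha] using h.share a ha
    · simpa [hTS a ha] using hshare a ha
  · intro a ha b hb e he
    rcases mem_union.1 ha with ha | ha <;> rcases mem_union.1 hb with hb | hb
    · simp only [ha, hb, if_true] at he ⊢
      exact h.efx a ha b hb e he
    · simp only [ha, hTS b hb, if_true, if_false] at he ⊢
      by_contra! hc
      exact hmin b hb e he a (Or.inl ⟨ha, hc⟩)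
    · simp only [hb, hTS a ha, if_true, if_false] at he ⊢
      exact (hmono a _ _ sdiff_subset).trans
        ((h.out a (hTS a ha) b hb).le.trans (hshare a ha))
    · simp only [hTS a ha, hTS b hb, if_false] at he ⊢
      by_contra! hc
      exact hmin b hb e he a (Or.inr ⟨hTS a ha, (hshare a ha).trans hc.le⟩)
  · intro a ha b hb
    rw [mem_union, not_or] at ha
    rcases mem_union.1 hb with hb | hb
    · simpa [hb] using h.out a ha.1 b hb
    · simpa [hTS b hb] using hout a ha.1 ha.2 b hb

/-- A partial EFX allocation leaving out an agent with a residual self-feasible threshold can be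
improved, by growing the set of served agents or by giving one of them a better bundle. -/
theorem IsPartialEFX.exists_better [Fintype M]
    (hmono : ∀ i, ∀ S T : Finset M, S ⊆ T → v i S ≤ v i T)
    (hr : ∀ i, RSF (v i) n univ (r i)) (h : IsPartialEFX v r S A) (hS : S ≠ univ) :
    ∃ S' A', IsPartialEFX v r S' A' ∧
      (S.card < S'.card ∨ S' = S ∧ ∑ i ∈ S, v i (A i) < ∑ i ∈ S, v i (A' i)) := by
  classical
  obtain ⟨i, hi⟩ : ∃ i, i ∉ S := by
    by_contra! hc
    exact hS (eq_univ_iff_forall.2 hc)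
  have hSn : S.card < n := by
    simpa using card_lt_card (ssubset_univ_iff.2 hS)
  obtain ⟨P, hPdisj, hPun, hPr⟩ := hr i S.card hSn (fun k => A (S.equivFin.symm k))
    (fun a b hab => h.disj _ (S.equivFin.symm a).2 _ (S.equivFin.symm b).2
      fun hc => hab (S.equivFin.symm.injective (Subtype.ext hc)))
    (fun _ => subset_univ _) (fun a => h.out i hi _ (S.equivFin.symm a).2)
  have hPA : ∀ j ∈ S, ∀ t, Disjoint (A j) (P t) := by
    intro j hj t
    refine Finset.disjoint_right.2 fun x hx hxj => ?_
    have hx' : x ∈ univ.biUnion P := mem_biUnion.2 ⟨t, mem_univ _, hx⟩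
    rw [hPun, mem_sdiff] at hx'
    exact hx'.2 (mem_biUnion.2 ⟨S.equivFin ⟨j, hj⟩, mem_univ _, by simpa using hxj⟩)
  have hshrink : ∀ t, ∃ B ⊆ P t, (∃ l, Wants v r S A B l) ∧
      ∀ e ∈ B, ∀ l, ¬ Wants v r S A (B \ {e}) l := by
    intro t
    obtain ⟨B, hBP, hB⟩ := exists_minimal_le_of_wellFoundedLT
      (fun B => ∃ l, Wants v r S A B l) (P t) ⟨i, Or.inr ⟨hi, hPr t⟩⟩
    refine ⟨B, hBP, hB.prop, fun e he l hl => ?_⟩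
    have := hB.le_of_le ⟨l, hl⟩ sdiff_subset he
    simp at this
  choose B hBP hBw hBmin using hshrink
  by_cases hcase : ∃ t, ∀ l ∉ S, v l (B t) < r l
  · obtain ⟨t, ht⟩ := hcase
    obtain ⟨j, ⟨hj, hlt⟩ | ⟨hj, hle⟩⟩ := hBw t
    · refine ⟨S, _, h.update hj
        (fun a ha _ => (hPA a ha t).mono_right (hBP t)) hlt (hBmin t) ht, Or.inr ⟨rfl, ?_⟩⟩
      exact sum_lt_sum (fun a _ => le_update hlt.le a) ⟨j, hj, by simpa using hlt⟩
    · exact absurd (ht j hj) hle.not_gt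
  · push Not at hcase
    have : Nonempty (Fin (n - S.card)) := ⟨⟨0, by omega⟩⟩
    obtain ⟨T, hTne, g, hinj, hg, hclosed⟩ := exists_closed_matching
      (fun t => Sᶜ.filter fun l => r l ≤ v l (B t))
      (fun t => by
        obtain ⟨l, hl, hlr⟩ := hcase t
        exact ⟨l, by simp [hl, hlr]⟩)
      (by
        have hsub : (univ.biUnion fun t => Sᶜ.filter fun l => r l ≤ v l (B t)) ⊆ Sᶜ :=
          biUnion_subset.2 fun _ _ => filter_subset _ _
        simpa [card_compl] using card_le_card hsub)
    have hT : ∀ a ∈ T, a ∉ S ∧ r a ≤ v a (B (g a)) := fun a ha => by simpa using hg a ha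
    have hdisj : Disjoint S T := Finset.disjoint_right.2 fun a ha => (hT a ha).1
    refine ⟨S ∪ T, _, h.union hmono hdisj (B := fun a => B (g a)) ?_ ?_ (fun a ha => (hT a ha).2)
      (fun a _ => hBmin (g a)) ?_, Or.inl ?_⟩
    · exact fun a ha b _ => (hPA a ha _).mono_right (hBP _)
    · exact fun a ha b hb hab => (hPdisj _ _ fun hc => hab (hinj ha hb hc)).mono (hBP _) (hBP _)
    · intro l hlS hlT a ha
      by_contra! hc
      exact hlT (hclosed a ha (by simp [hlS, hc]))
    · rw [card_union_of_disjoint hdisj]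
      have := hTne.card_pos
      omega

/-- Some partial EFX allocation serves all agents, and no agent prefers an unallocated item to
its own bundle. -/
theorem exists_isPartialEFX_univ [Fintype M]
    (hmono : ∀ i, ∀ S T : Finset M, S ⊆ T → v i S ≤ v i T) (hzero : ∀ i, v i ∅ = 0)
    (hr : ∀ i, RSF (v i) n univ (r i)) :
    ∃ A, IsPartialEFX v r univ A ∧ ∀ x ∉ univ.biUnion A, ∀ i, v i {x} ≤ v i (A i) := by
  obtain ⟨⟨S, A⟩, h, hmax⟩ := exists_lex_max
    (fun s : Finset (Fin n) × (Fin n → Finset M) => IsPartialEFX v r s.1 s.2)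
    ⟨(∅, fun _ => ∅), by constructor <;> simp⟩ (fun s => s.1.card)
    (fun s => ∑ i ∈ s.1, v i (s.2 i))
  simp only at h hmax
  have hS : S = univ := by
    by_contra hS
    obtain ⟨S', A', h', hlt⟩ := h.exists_better hmono hr hS
    rcases hlt with hlt | ⟨rfl, hlt⟩
    · have := hmax (S', A') h'
      simp only at this
      omega
    · rcases hmax (S', A') h' with hc | hc
      · exact lt_irrefl _ hc
      · exact hc.2.not_gt hlt
  subst hS
  refine ⟨A, h, fun x hx i => ?_⟩
  by_contra! hlt
  have h' := h.update (mem_univ i) (B := {x})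
    (fun j hj _ => by
      rw [Finset.disjoint_singleton_right]
      exact fun hxj => hx (mem_biUnion.2 ⟨j, hj, hxj⟩))
    hlt (fun e he l => by
      rw [mem_singleton] at he
      simp [Wants, he, hzero]) (by simp)
  rcases hmax (univ, Function.update A i {x}) h' with hc | hc
  · exact lt_irrefl _ hc
  · exact hc.2.not_gt
      (sum_lt_sum (fun a _ => le_update hlt.le a) ⟨i, mem_univ _, by simpa using hlt⟩)

/-- A partial allocation in which every agent reaches its threshold, has no EFL envy, and does
not prefer an unallocated item to its own bundle. -/
structure IsPartialEFL (v : Fin n → Finset M → NNReal) (r : Fin n → NNReal)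
    (A : Fin n → Finset M) : Prop where
  disj : ∀ i j, i ≠ j → Disjoint (A i) (A j)
  share : ∀ i, r i ≤ v i (A i)
  efl : ∀ i j, 2 ≤ (A j).card → ∃ e ∈ A j, v i {e} ≤ v i (A i) ∧ v i (A j \ {e}) ≤ v i (A i)
  pool : ∀ x, (∀ j, x ∉ A j) → ∀ i, v i {x} ≤ v i (A i)

theorem IsPartialEFX.isPartialEFL [Fintype M]
    (hmono : ∀ i, ∀ S T : Finset M, S ⊆ T → v i S ≤ v i T) (h : IsPartialEFX v r univ A)
    (hpool : ∀ x ∉ univ.biUnion A, ∀ i, v i {x} ≤ v i (A i)) : IsPartialEFL v r A where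
  disj i j := h.disj i (mem_univ _) j (mem_univ _)
  share i := h.share i (mem_univ _)
  efl i j hj := by
    obtain ⟨e, he, e', he', hne⟩ := one_lt_card.1 (show 1 < (A j).card by omega)
    refine ⟨e, he, ?_, h.efx i (mem_univ _) j (mem_univ _) e he⟩
    refine (hmono i _ _ ?_).trans (h.efx i (mem_univ _) j (mem_univ _) e' he')
    simpa using ⟨he, hne⟩
  pool x hx := hpool x (by simpa using hx)

/-- Exchanging bundles so that nobody loses preserves `IsPartialEFL`. -/
theorem IsPartialEFL.comp_perm (h : IsPartialEFL v r A) (τ : Equiv.Perm (Fin n))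
    (hle : ∀ i, v i (A i) ≤ v i (A (τ i))) : IsPartialEFL v r (A ∘ τ) where
  disj i j hij := h.disj _ _ (τ.injective.ne hij)
  share i := (h.share i).trans (hle i)
  efl i j hj := by
    obtain ⟨e, he, h1, h2⟩ := h.efl i (τ j) hj
    exact ⟨e, he, h1.trans (hle i), h2.trans (hle i)⟩
  pool x hx i := (h.pool x (fun j => by simpa using hx (τ.symm j)) i).trans (hle i)

/-- Giving an unallocated item to an agent whom nobody envies preserves `IsPartialEFL`. -/
theorem IsPartialEFL.insert (hmono : ∀ i, ∀ S T : Finset M, S ⊆ T → v i S ≤ v i T)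
    (h : IsPartialEFL v r A) {x : M} (hx : ∀ j, x ∉ A j) {k : Fin n}
    (hk : ∀ i, v i (A k) ≤ v i (A i)) :
    IsPartialEFL v r (Function.update A k (insert x (A k))) := by
  have hle := le_update (hmono k _ _ (subset_insert x (A k)))
  constructor
  · intro a b hab
    by_cases hak : a = k
    · subst hak
      simpa [hab.symm, hx b] using h.disj a b hab
    · by_cases hbk : b = k
      · subst hbk
        simpa [hak, hx a] using h.disj a b hab
      · simpa [hak, hbk] using h.disj a b hab
  · exact fun i => (h.share i).trans (hle i)
  · intro i j hj
    by_cases hjk : j = k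
    · subst hjk
      refine ⟨x, by simp, (h.pool x hx i).trans (hle i), le_trans ?_ (hle i)⟩
      refine (hmono i _ _ ?_).trans (hk i)
      intro y hy
      simp only [Function.update_self, mem_sdiff, mem_insert, mem_singleton] at hy
      tauto
    · simp only [Function.update_of_ne hjk] at hj ⊢
      obtain ⟨e, he, h1, h2⟩ := h.efl i j hj
      exact ⟨e, he, h1.trans (hle i), h2.trans (hle i)⟩
  · intro y hy i
    refine (h.pool y (fun j hyj => hy j ?_) i).trans (hle i)
    by_cases hjk : j = k
    · subst hjk; simp [hyj]
    · simpa [hjk] using hyj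

/-- A partial EFL allocation extends, by envy-cycle elimination, to one allocating all items. -/
theorem IsPartialEFL.exists_full [Fintype M] (hn : 1 ≤ n)
    (hmono : ∀ i, ∀ S T : Finset M, S ⊆ T → v i S ≤ v i T)
    (h : IsPartialEFL v r A) : ∃ A', IsPartialEFL v r A' ∧ univ.biUnion A' = univ := by
  have : Nonempty (Fin n) := ⟨⟨0, hn⟩⟩
  obtain ⟨A', h', hmax⟩ := exists_lex_max (IsPartialEFL v r) ⟨A, h⟩
    (fun A => (univ.biUnion A).card) (fun A => ∑ i, v i (A i))
  refine ⟨A', h', ?_⟩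
  obtain ⟨k, hk⟩ : ∃ k, ∀ i, v i (A' k) ≤ v i (A' i) := by
    by_contra! hc
    choose p hp using hc
    obtain ⟨σ, ⟨j, hj⟩, hσ⟩ := exists_perm_of_self_map p
    have hle : ∀ i, v i (A' i) ≤ v i (A' (σ.symm i)) := by
      intro i
      obtain ⟨l, rfl⟩ := σ.surjective i
      rw [Equiv.symm_apply_apply]
      rcases hσ l with hl | hl
      · rw [hl]; exact (hp l).le
      · rw [hl]
    have hun : univ.biUnion (A' ∘ σ.symm) = univ.biUnion A' := by
      ext x
      simpa using σ.symm.exists_congr_left (p := fun i => x ∈ A' (σ.symm i))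
    rcases hmax _ (h'.comp_perm σ.symm hle) with hc | hc
    · rw [hun] at hc; exact lt_irrefl _ hc
    · refine hc.2.not_gt (sum_lt_sum (fun i _ => hle i) ⟨σ j, mem_univ _, ?_⟩)
      rw [Function.comp_apply, Equiv.symm_apply_apply, hj]
      exact hp j
  rw [eq_univ_iff_forall]
  by_contra! hc
  obtain ⟨x, hx⟩ := hc
  have hx' : ∀ j, x ∉ A' j := by simpa using hx
  have hlt : (univ.biUnion A').card <
      (univ.biUnion (Function.update A' k (Insert.insert x (A' k)))).card := by
    refine card_lt_card ⟨fun y hy => ?_, fun hsub => hx (hsub ?_)⟩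
    · obtain ⟨j, -, hj⟩ := mem_biUnion.1 hy
      refine mem_biUnion.2 ⟨j, mem_univ _, ?_⟩
      by_cases hjk : j = k
      · subst hjk; simp [hj]
      · simpa [hjk] using hj
    · exact mem_biUnion.2 ⟨k, mem_univ _, by simp⟩
  rcases hmax _ (h'.insert hmono hx' hk) with hc | hc <;> omega

end Allocation

/-- In every allocation instance with monotone valuations there is a full allocation
that is simultaneously RMMS and EFL. -/
theorem exists_full_rmms_efl {M : Type*} [Fintype M] [DecidableEq M]
    (n : ℕ) (hn : 1 ≤ n)
    (v : Fin n → Finset M → NNReal)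
    (hmono : ∀ i, ∀ S T : Finset M, S ⊆ T → v i S ≤ v i T)
    (hzero : ∀ i, v i ∅ = 0)
    (r : Fin n → NNReal)
    (hr : ∀ i, IsGreatest {t : NNReal | RSF (v i) n (Finset.univ : Finset M) t} (r i)) :
    ∃ A : Fin n → Finset M, IsPartitionOn Finset.univ A ∧
      (∀ i, r i ≤ v i (A i)) ∧
      (∀ i j, ¬ (2 ≤ (A j).card ∧
        ∀ e ∈ A j, v i (A i) < v i {e} ∨ v i (A i) < v i (A j \ {e}))) := by
  obtain ⟨A₀, h₀, hpool⟩ := exists_isPartialEFX_univ hmono hzero fun i => (hr i).1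
  obtain ⟨A, h, hfull⟩ := (h₀.isPartialEFL hmono hpool).exists_full hn hmono
  refine ⟨A, ⟨h.disj, hfull⟩, h.share, fun i j ⟨hcard, henvy⟩ => ?_⟩
  obtain ⟨e, he, h1, h2⟩ := h.efl i j hcard
  exact (henvy e he).elim h1.not_gt h2.not_gt
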